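/- (Corollary 2.) Assume (A0) and (A1). Let $(a,\rho)$ be the solution of the Friedmann system with initial data $a(0)=a_0>0$, $a'(0)=\dot a_0$, $\rho(0)=\rho_0>0$, on its maximal interval of existence $]t_-,t_+[$ in $\{a>0,\ \rho>0\}$. If $\dot a_0>0$ and $\big(\tfrac{8\pi G}{3}\rho_0+\tfrac{c^2\Lambda}{3}\big)a_0^2\le\dot a_0^2$ (i.e. $K\le 0$), then $t_+=+\infty$, and $a(t)\to+\infty$ and $\rho(t)\to 0$ as $t\to+\infty$. -/

import Mathlib

open Real Filter Set Topology Asymptotics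

/-- Assumption (A0): `P` is a smooth function of `ρ > 0` with `0 ≤ P`,
`0 ≤ dP/dρ < c²` for `ρ > 0`, and `P → 0` as `ρ → 0⁺`. -/
def A0 (c : ℝ) (P : ℝ → ℝ) : Prop :=
  ContDiffOn ℝ (⊤ : ℕ∞) P (Set.Ioi 0) ∧
  (∀ ρ > (0 : ℝ), 0 ≤ P ρ) ∧
  (∀ ρ > (0 : ℝ), 0 ≤ deriv P ρ ∧ deriv P ρ < c ^ 2) ∧
  Filter.Tendsto P (nhdsWithin 0 (Set.Ioi 0)) (nhds 0)

/-- A solution of the Friedmann system on a set `I`: `a > 0`, `ρ > 0`,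
`a'' = (-(4πG/3)(ρ + 3P(ρ)/c²) + c²Λ/3) a` and `ρ' = -3(ρ + P(ρ)/c²) a'/a`. -/
def IsFriedmannSolution (c G Λ : ℝ) (P : ℝ → ℝ) (a ρ : ℝ → ℝ) (I : Set ℝ) : Prop :=
  ∀ t ∈ I, 0 < a t ∧ 0 < ρ t ∧
    DifferentiableAt ℝ a t ∧
    HasDerivAt (deriv a)
      ((-(4 * Real.pi * G / 3) * (ρ t + 3 * P (ρ t) / c ^ 2) + c ^ 2 * Λ / 3) * a t) t ∧
    HasDerivAt ρ (-3 * (ρ t + P (ρ t) / c ^ 2) * (deriv a t / a t)) t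

/-- `(a, ρ)` is a solution of the Friedmann system on the maximal interval of existence
`]t₋, t₊[` (with `-∞ ≤ t₋ < 0 < t₊ ≤ +∞`) in the domain `{a > 0, ρ > 0}`: the solution
property holds on `]t₋, t₊[`, and any solution with the same initial data at `t = 0`
is defined on a subinterval of `]t₋, t₊[`. -/
def IsMaximalSolution (c G Λ : ℝ) (P : ℝ → ℝ) (a ρ : ℝ → ℝ) (tm tp : EReal) : Prop :=
  tm < (0 : EReal) ∧ (0 : EReal) < tp ∧
  IsFriedmannSolution c G Λ P a ρ {t : ℝ | tm < (t : EReal) ∧ (t : EReal) < tp} ∧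
  ∀ (b σ : ℝ → ℝ) (s u : ℝ), s < 0 → 0 < u →
    IsFriedmannSolution c G Λ P b σ (Set.Ioo s u) →
    b 0 = a 0 → deriv b 0 = deriv a 0 → σ 0 = ρ 0 →
    tm ≤ (s : EReal) ∧ (u : EReal) ≤ tp

/-- Assumption (A1): there are `1 ≤ Γ < 2` and `0 < σ ≤ 1` such that
`P(ρ) = (Γ-1) c² ρ (1 + O(ρ^{-σ}))` as `ρ → +∞`. -/
def A1 (c : ℝ) (P : ℝ → ℝ) (Γ σ : ℝ) : Prop :=
  1 ≤ Γ ∧ Γ < 2 ∧ 0 < σ ∧ σ ≤ 1 ∧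
  ∃ E : ℝ → ℝ, (∀ᶠ ρ in Filter.atTop, P ρ = (Γ - 1) * c ^ 2 * ρ * (1 + E ρ)) ∧
    E =O[Filter.atTop] fun ρ : ℝ => ρ ^ (-σ)

theorem A0.le_mul {c : ℝ} {P : ℝ → ℝ} (h : A0 c P) {r : ℝ} (hr : 0 < r) : P r ≤ c ^ 2 * r := by
  obtain ⟨hsmooth, -, hder, hlim⟩ := h
  have hd : ∀ x > (0 : ℝ), HasDerivAt P (deriv P x) x := fun x hx =>
    ((hsmooth.contDiffAt (Ioi_mem_nhds hx)).differentiableAt (by simp)).hasDerivAt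
  have hd' : ∀ x > (0 : ℝ), HasDerivAt (fun y => P y - c ^ 2 * y) (deriv P x - c ^ 2) x :=
    fun x hx => by
      exact ((hd x hx).fun_sub ((hasDerivAt_id x).const_mul (c ^ 2))).congr_deriv (by simp)
  have hanti : AntitoneOn (fun y => P y - c ^ 2 * y) (Ioi 0) := by
    refine antitoneOn_of_hasDerivWithinAt_nonpos (f' := fun x => deriv P x - c ^ 2)
      (convex_Ioi 0) (fun x hx => (hd' x hx).continuousAt.continuousWithinAt)
      (fun x hx => (hd' x (interior_subset hx)).hasDerivWithinAt) fun x hx => ?_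
    linarith [(hder x (interior_subset hx)).2]
  have hlim' : Tendsto (fun y => P y - c ^ 2 * y) (𝓝[>] 0) (𝓝 0) := by
    have : Tendsto (fun y : ℝ => c ^ 2 * y) (𝓝[>] 0) (𝓝 0) := by
      have h0 : Tendsto (fun y : ℝ => c ^ 2 * y) (𝓝 0) (𝓝 (c ^ 2 * 0)) :=
        tendsto_id.const_mul _
      rw [mul_zero] at h0
      exact h0.mono_left nhdsWithin_le_nhds
    simpa using hlim.sub this
  have : P r - c ^ 2 * r ≤ 0 := by
    refine ge_of_tendsto hlim' ?_
    filter_upwards [Ioo_mem_nhdsGT hr] with x hx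
    exact hanti hx.1 hr hx.2.le
  linarith

theorem monotoneOn_of_hasDerivAt_nonneg {D : Set ℝ} (hD : Convex ℝ D) {f f' : ℝ → ℝ}
    (hf : ∀ x ∈ D, HasDerivAt f (f' x) x) (hf' : ∀ x ∈ D, 0 ≤ f' x) : MonotoneOn f D :=
  monotoneOn_of_hasDerivWithinAt_nonneg hD
    (fun x hx => (hf x hx).continuousAt.continuousWithinAt)
    (fun x hx => (hf x (interior_subset hx)).hasDerivWithinAt)
    fun x hx => hf' x (interior_subset hx)

/-- Lower Grönwall bound: `C f ≤ f'` implies `f 0 * exp (C t) ≤ f t` for `t ≥ 0`. -/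
theorem mul_exp_le_of_hasDerivAt {D : Set ℝ} (hD : Convex ℝ D) {f f' : ℝ → ℝ} {C t : ℝ}
    (hf : ∀ x ∈ D, HasDerivAt f (f' x) x) (hf' : ∀ x ∈ D, C * f x ≤ f' x)
    (h0 : 0 ∈ D) (ht : t ∈ D) (ht0 : 0 ≤ t) : f 0 * exp (C * t) ≤ f t := by
  have hm : MonotoneOn (fun x => f x * exp (-C * x)) D := by
    refine monotoneOn_of_hasDerivAt_nonneg hD
      (f' := fun x => f' x * exp (-C * x) + f x * (exp (-C * x) * (-C * 1)))
      (fun x hx => (hf x hx).mul (((hasDerivAt_id x).const_mul (-C)).exp)) fun x hx => ?_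
    have : 0 ≤ (f' x - C * f x) * exp (-C * x) :=
      mul_nonneg (sub_nonneg.2 (hf' x hx)) (exp_pos _).le
    linarith
  have h := hm h0 ht ht0
  simp only [mul_zero, exp_zero, mul_one] at h
  calc f 0 * exp (C * t) ≤ f t * exp (-C * t) * exp (C * t) :=
        mul_le_mul_of_nonneg_right h (exp_pos _).le
    _ = f t := by rw [mul_assoc, ← exp_add]; simp

/-- Upper Grönwall bound: `f' ≤ C f` implies `f t ≤ f 0 * exp (C t)` for `t ≥ 0`. -/
theorem le_mul_exp_of_hasDerivAt {D : Set ℝ} (hD : Convex ℝ D) {f f' : ℝ → ℝ} {C t : ℝ}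
    (hf : ∀ x ∈ D, HasDerivAt f (f' x) x) (hf' : ∀ x ∈ D, f' x ≤ C * f x)
    (h0 : 0 ∈ D) (ht : t ∈ D) (ht0 : 0 ≤ t) : f t ≤ f 0 * exp (C * t) := by
  have h := mul_exp_le_of_hasDerivAt (f := fun x => -f x) (f' := fun x => -f' x) (C := C) hD
    (fun x hx => (hf x hx).neg) (fun x hx => by linarith [hf' x hx]) h0 ht ht0
  linarith

/-- Concatenation of two integral curves of an autonomous vector field at a common endpoint. -/
theorem hasDerivAt_ite_of_integralCurves {E : Type*} [NormedAddCommGroup E] [NormedSpace ℝ E]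
    {F : E → E} {γ α : ℝ → E} {x : E} {s T u : ℝ} (hsT : s < T)
    (hγ : ∀ t ∈ Ioo s T, HasDerivAt γ (F (γ t)) t) (hlim : Tendsto γ (𝓝[<] T) (𝓝 x))
    (hαT : α T = x) (hα : ∀ t ∈ Ico T u, HasDerivAt α (F (α t)) t) (hF : ContinuousAt F x)
    {t : ℝ} (ht : t ∈ Ioo s u) :
    HasDerivAt (fun r => if r < T then γ r else α r) (F (if t < T then γ t else α t)) t := by
  have hleft : ∀ r < T, (fun r => if r < T then γ r else α r) =ᶠ[𝓝 r] γ := fun r hr => by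
    filter_upwards [Iio_mem_nhds hr] with y hy
    exact if_pos hy
  rcases lt_trichotomy t T with h | h | h
  · rw [if_pos h]
    exact (hγ t ⟨ht.1, h⟩).congr_of_eventuallyEq (hleft t h)
  · subst h
    simp only [lt_irrefl, if_false]
    have hR : HasDerivWithinAt (fun r => if r < t then γ r else α r) (F (α t)) (Ici t) t :=
      (hα t ⟨le_rfl, ht.2⟩).hasDerivWithinAt.congr
        (fun y hy => if_neg (not_lt.2 hy)) (if_neg (lt_irrefl t))
    have hd : ∀ r ∈ Ioo s t, HasDerivAt (fun r => if r < t then γ r else α r) (F (γ r)) r :=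
      fun r hr => (hγ r hr).congr_of_eventuallyEq (hleft r hr.2)
    have hL : HasDerivWithinAt (fun r => if r < t then γ r else α r) (F (α t)) (Iic t) t := by
      refine hasDerivWithinAt_Iic_of_tendsto_deriv (s := Ioo s t)
        (fun r hr => (hd r hr).differentiableAt.differentiableWithinAt) ?_
        (Ioo_mem_nhdsLT hsT) ?_
      · have h1 : Tendsto (fun r => if r < t then γ r else α r) (𝓝[<] t) (𝓝 x) := by
          refine hlim.congr' ?_
          filter_upwards [self_mem_nhdsWithin] with y hy
          exact (if_pos hy).symm
        have h2 : (fun r => if r < t then γ r else α r) t = x := by simp [hαT]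
        unfold ContinuousWithinAt
        rw [h2]
        exact h1.mono_left (nhdsWithin_mono _ Ioo_subset_Iio_self)
      · rw [hαT]
        refine (hF.tendsto.comp hlim).congr' ?_
        filter_upwards [Ioo_mem_nhdsLT hsT] with r hr
        exact (hd r hr).deriv.symm
    have := hL.union hR
    rwa [Iic_union_Ici, hasDerivWithinAt_univ] at this
  · rw [if_neg (not_lt.2 h.le)]
    refine (hα t ⟨h.le, ht.2⟩).congr_of_eventuallyEq ?_
    filter_upwards [Ioi_mem_nhds h] with y hy
    exact if_neg (not_lt.2 (le_of_lt hy))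

/-- The Friedmann system as an autonomous vector field in the variables `(a, a', ρ)`. -/
noncomputable def friedmannField (c G Λ : ℝ) (P : ℝ → ℝ) (y : ℝ × ℝ × ℝ) : ℝ × ℝ × ℝ :=
  (y.2.1,
    (-(4 * Real.pi * G / 3) * (y.2.2 + 3 * P y.2.2 / c ^ 2) + c ^ 2 * Λ / 3) * y.1,
    -3 * (y.2.2 + P y.2.2 / c ^ 2) * (y.2.1 / y.1))

theorem contDiffAt_friedmannField {c G Λ : ℝ} {P : ℝ → ℝ} (hP : A0 c P)
    {y : ℝ × ℝ × ℝ} (ha : 0 < y.1) (hρ : 0 < y.2.2) :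
    ContDiffAt ℝ 1 (friedmannField c G Λ P) y := by
  have h1 : ContDiffAt ℝ 1 (fun z : ℝ × ℝ × ℝ => z.1) y := contDiffAt_fst
  have h2 : ContDiffAt ℝ 1 (fun z : ℝ × ℝ × ℝ => z.2.1) y := by fun_prop
  have h3 : ContDiffAt ℝ 1 (fun z : ℝ × ℝ × ℝ => z.2.2) y := by fun_prop
  have hPy : ContDiffAt ℝ 1 (fun z : ℝ × ℝ × ℝ => P z.2.2) y :=
    ((hP.1.contDiffAt (Ioi_mem_nhds hρ)).of_le (by exact_mod_cast le_top)).comp y h3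
  unfold friedmannField
  refine h2.prodMk (ContDiffAt.prodMk ?_ ?_)
  · exact ((contDiffAt_const.mul (h3.add ((contDiffAt_const.mul hPy).div_const _))).add
      contDiffAt_const).mul h1
  · exact (contDiffAt_const.mul (h3.add (hPy.div_const _))).mul (h2.div h1 ha.ne')

theorem IsFriedmannSolution.mono {c G Λ : ℝ} {P a ρ : ℝ → ℝ} {I J : Set ℝ}
    (h : IsFriedmannSolution c G Λ P a ρ J) (hIJ : I ⊆ J) :
    IsFriedmannSolution c G Λ P a ρ I :=
  fun t ht => h t (hIJ ht)

theorem IsFriedmannSolution.hasDerivAt_curve {c G Λ : ℝ} {P a ρ : ℝ → ℝ} {I : Set ℝ}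
    (h : IsFriedmannSolution c G Λ P a ρ I) {t : ℝ} (ht : t ∈ I) :
    HasDerivAt (fun r => (a r, deriv a r, ρ r))
      (friedmannField c G Λ P (a t, deriv a t, ρ t)) t := by
  obtain ⟨-, -, h1, h2, h3⟩ := h t ht
  exact h1.hasDerivAt.prodMk (h2.prodMk h3)

theorem isFriedmannSolution_of_curve {c G Λ : ℝ} {P : ℝ → ℝ} {I : Set ℝ} (hI : IsOpen I)
    {Y : ℝ → ℝ × ℝ × ℝ} (hY : ∀ t ∈ I, HasDerivAt Y (friedmannField c G Λ P (Y t)) t)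
    (hpos : ∀ t ∈ I, 0 < (Y t).1 ∧ 0 < (Y t).2.2) :
    IsFriedmannSolution c G Λ P (fun t => (Y t).1) (fun t => (Y t).2.2) I := by
  have hfst : ∀ t ∈ I, HasDerivAt (fun r => (Y r).1) (Y t).2.1 t := fun t ht => (hY t ht).fst
  intro t ht
  have hev : deriv (fun r => (Y r).1) =ᶠ[𝓝 t] fun r => (Y r).2.1 := by
    filter_upwards [hI.mem_nhds ht] with r hr
    exact (hfst r hr).deriv
  refine ⟨(hpos t ht).1, (hpos t ht).2, (hfst t ht).differentiableAt, ?_, ?_⟩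
  · exact HasDerivAt.congr_of_eventuallyEq (hY t ht).snd.fst hev
  · rw [hev.eq_of_nhds]
    exact (hY t ht).snd.snd

/-- A solution with a limit in the phase domain `{a > 0, ρ > 0}` at a finite endpoint extends
past that endpoint. -/
theorem IsFriedmannSolution.exists_extension {c G Λ : ℝ} {P a ρ : ℝ → ℝ} (hP : A0 c P)
    {s T : ℝ} (hs : s < 0) (hT : 0 < T) (h : IsFriedmannSolution c G Λ P a ρ (Ioo s T))
    {y : ℝ × ℝ × ℝ} (hy1 : 0 < y.1) (hy2 : 0 < y.2.2)
    (hlim : Tendsto (fun r => (a r, deriv a r, ρ r)) (𝓝[<] T) (𝓝 y)) :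
    ∃ (b σ : ℝ → ℝ) (u : ℝ), T < u ∧ IsFriedmannSolution c G Λ P b σ (Ioo s u) ∧
      b 0 = a 0 ∧ deriv b 0 = deriv a 0 ∧ σ 0 = ρ 0 := by
  have hF := contDiffAt_friedmannField (G := G) (Λ := Λ) hP hy1 hy2
  obtain ⟨α, hα0, ε, hε, hα⟩ :=
    hF.exists_forall_mem_closedBall_exists_eq_forall_mem_Ioo_hasDerivAt₀ T
  have hcont : ContinuousAt α T := (hα T ⟨by linarith, by linarith⟩).continuousAt
  have hp : ∀ᶠ t in 𝓝 T, 0 < (α t).1 ∧ 0 < (α t).2.2 := by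
    have h1 : ContinuousAt (fun t => (α t).1) T := hcont.fst
    have h2 : ContinuousAt (fun t => (α t).2.2) T := hcont.snd.snd
    exact (h1.eventually (lt_mem_nhds (by simpa [hα0] using hy1))).and
      (h2.eventually (lt_mem_nhds (by simpa [hα0] using hy2)))
  obtain ⟨δ, hδ, hball⟩ := Metric.eventually_nhds_iff.1 hp
  let Y : ℝ → ℝ × ℝ × ℝ := fun r => if r < T then (a r, deriv a r, ρ r) else α r
  have hYa : Y =ᶠ[𝓝 0] fun r => (a r, deriv a r, ρ r) := by
    filter_upwards [Iio_mem_nhds hT] with r hr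
    exact if_pos hr
  refine ⟨fun t => (Y t).1, fun t => (Y t).2.2, T + min ε δ, by simp [hε, hδ], ?_, ?_, ?_, ?_⟩
  · refine isFriedmannSolution_of_curve isOpen_Ioo (fun t ht => ?_) fun t ht => ?_
    · refine hasDerivAt_ite_of_integralCurves (hs.trans hT)
        (fun r hr => h.hasDerivAt_curve hr) hlim hα0 (fun r hr => hα r ⟨?_, ?_⟩)
        hF.continuousAt ht
      · linarith [hr.1]
      · linarith [hr.2, min_le_left ε δ]
    · by_cases htT : t < T
      · obtain ⟨h1, h2, -⟩ := h t ⟨ht.1, htT⟩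
        simp only [Y, if_pos htT]
        exact ⟨h1, h2⟩
      · simp only [Y, if_neg htT]
        refine hball ?_
        rw [Real.dist_eq, abs_of_nonneg (by linarith [not_lt.1 htT])]
        linarith [ht.2, min_le_right ε δ]
  · exact congrArg Prod.fst hYa.eq_of_nhds
  · exact (hYa.fun_comp Prod.fst).deriv_eq
  · exact congrArg (fun z : ℝ × ℝ × ℝ => z.2.2) hYa.eq_of_nhds

/-- Conservation of the curvature constant `c² K`. -/
theorem IsFriedmannSolution.energy_eq {c G Λ : ℝ} {P a ρ : ℝ → ℝ} {D : Set ℝ}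
    (hD : Convex ℝ D) (h0 : 0 ∈ D) (h : IsFriedmannSolution c G Λ P a ρ D) {t : ℝ}
    (ht : t ∈ D) (ht0 : 0 ≤ t) :
    (8 * Real.pi * G / 3 * ρ t + c ^ 2 * Λ / 3) * a t ^ 2 - deriv a t ^ 2 =
      (8 * Real.pi * G / 3 * ρ 0 + c ^ 2 * Λ / 3) * a 0 ^ 2 - deriv a 0 ^ 2 := by
  have hd : ∀ x ∈ D, HasDerivAt
      (fun t => (8 * Real.pi * G / 3 * ρ t + c ^ 2 * Λ / 3) * a t ^ 2 - deriv a t ^ 2) 0 x := by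
    intro x hx
    obtain ⟨hpos, -, h1, h2, h3⟩ := h x hx
    have := (((h3.const_mul (8 * Real.pi * G / 3)).add_const (c ^ 2 * Λ / 3)).mul
      (h1.hasDerivAt.pow 2)).sub (h2.pow 2)
    refine this.congr_deriv ?_
    have : a x ≠ 0 := hpos.ne'
    simp only [Pi.pow_apply]
    field_simp
    ring
  have h1 := mul_exp_le_of_hasDerivAt (C := 0) hD hd (by simp) h0 ht ht0
  have h2 := le_mul_exp_of_hasDerivAt (C := 0) hD hd (by simp) h0 ht ht0
  simp only [zero_mul, exp_zero, mul_one] at h1 h2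
  exact le_antisymm h2 h1

section Expanding

variable {c G Λ : ℝ} {P a ρ : ℝ → ℝ} {D : Set ℝ}

theorem IsFriedmannSolution.sq_deriv_eq (hD : Convex ℝ D) (h0 : 0 ∈ D) (hnn : ∀ t ∈ D, 0 ≤ t)
    (h : IsFriedmannSolution c G Λ P a ρ D)
    (hK : (8 * Real.pi * G / 3 * ρ 0 + c ^ 2 * Λ / 3) * a 0 ^ 2 ≤ deriv a 0 ^ 2) :
    ∃ k : ℝ, 0 ≤ k ∧ ∀ t ∈ D,
      deriv a t ^ 2 = (8 * Real.pi * G / 3 * ρ t + c ^ 2 * Λ / 3) * a t ^ 2 + k :=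
  ⟨_, sub_nonneg.2 hK, fun t ht => by linarith [h.energy_eq hD h0 ht (hnn t ht)]⟩

/-- When `K ≤ 0`, the Hubble rate stays bounded below by `√(c² Λ / 3)`. -/
theorem IsFriedmannSolution.sqrt_mul_le_deriv (hG : 0 < G) (hc : 0 < c) (hΛ : 0 < Λ)
    (hD : Convex ℝ D) (h0 : 0 ∈ D) (hnn : ∀ t ∈ D, 0 ≤ t)
    (h : IsFriedmannSolution c G Λ P a ρ D) (hv : 0 < deriv a 0)
    (hK : (8 * Real.pi * G / 3 * ρ 0 + c ^ 2 * Λ / 3) * a 0 ^ 2 ≤ deriv a 0 ^ 2)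
    {t : ℝ} (ht : t ∈ D) : √(c ^ 2 * Λ / 3) * a t ≤ deriv a t := by
  obtain ⟨k, hk, hsq⟩ := h.sq_deriv_eq hD h0 hnn hK
  have hlow : ∀ x ∈ D, (√(c ^ 2 * Λ / 3) * a x) ^ 2 ≤ deriv a x ^ 2 := fun x hx => by
    obtain ⟨ha, hρ, -⟩ := h x hx
    have : 0 ≤ 8 * Real.pi * G / 3 * ρ x * a x ^ 2 := by positivity
    rw [mul_pow, sq_sqrt (by positivity), hsq x hx]
    linarith
  have hne : ∀ x ∈ D, deriv a x ≠ 0 := fun x hx h0' => by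
    have ha := (h x hx).1
    have : 0 < (√(c ^ 2 * Λ / 3) * a x) ^ 2 := by positivity
    have := hlow x hx
    rw [h0'] at this
    linarith
  have hcont : ContinuousOn (deriv a) D :=
    fun x hx => (h x hx).2.2.2.1.continuousAt.continuousWithinAt
  have hpos : 0 < deriv a t := by
    by_contra hcon
    obtain ⟨x, hx, hx0⟩ := hD.isPreconnected.intermediate_value ht h0 hcont
      (show (0 : ℝ) ∈ Icc (deriv a t) (deriv a 0) from ⟨not_lt.1 hcon, hv.le⟩)
    exact hne x hx hx0
  exact le_of_sq_le_sq (hlow t ht) hpos.le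

/-- Bounds on the rate `ρ'` at density `r` and Hubble rate `H ∈ [m, M]`. -/
theorem A0.density_rate_bounds (hc : 0 < c) (hP : A0 c P) {r H m M : ℝ} (hr : 0 < r)
    (hm0 : 0 ≤ m) (hm : m ≤ H) (hM : H ≤ M) :
    -(6 * M) * r ≤ -3 * (r + P r / c ^ 2) * H ∧ -3 * (r + P r / c ^ 2) * H ≤ -(3 * m) * r := by
  have h1 : 0 ≤ P r / c ^ 2 := div_nonneg (hP.2.1 r hr) (by positivity)
  have h2 : P r / c ^ 2 ≤ r := by
    rw [div_le_iff₀ (by positivity)]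
    linarith [hP.le_mul hr]
  have h3 : (r + P r / c ^ 2) * H ≤ (2 * r) * M :=
    mul_le_mul (by linarith) hM (hm0.trans hm) (by linarith)
  have h4 : r * m ≤ (r + P r / c ^ 2) * H :=
    mul_le_mul (by linarith) hm hm0 (by linarith)
  constructor <;> linarith

/-- Exponential bounds for an expanding solution with `K ≤ 0`, together with monotonicity. -/
theorem IsFriedmannSolution.expanding (hG : 0 < G) (hc : 0 < c) (hΛ : 0 < Λ) (hP : A0 c P)
    (hD : Convex ℝ D) (h0 : 0 ∈ D) (hnn : ∀ t ∈ D, 0 ≤ t)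
    (h : IsFriedmannSolution c G Λ P a ρ D) (hv : 0 < deriv a 0)
    (hK : (8 * Real.pi * G / 3 * ρ 0 + c ^ 2 * Λ / 3) * a 0 ^ 2 ≤ deriv a 0 ^ 2) :
    MonotoneOn a D ∧ AntitoneOn ρ D ∧ ∀ t ∈ D,
      a 0 * exp (√(c ^ 2 * Λ / 3) * t) ≤ a t ∧
      a t ≤ a 0 * exp (deriv a 0 / a 0 * t) ∧
      ρ 0 * exp (-(6 * (deriv a 0 / a 0)) * t) ≤ ρ t ∧
      ρ t ≤ ρ 0 * exp (-(3 * √(c ^ 2 * Λ / 3)) * t) := by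
  have hlow : ∀ t ∈ D, √(c ^ 2 * Λ / 3) * a t ≤ deriv a t := fun t ht =>
    h.sqrt_mul_le_deriv hG hc hΛ hD h0 hnn hv hK ht
  have hda : ∀ t ∈ D, HasDerivAt a (deriv a t) t := fun t ht => (h t ht).2.2.1.hasDerivAt
  have hdρ : ∀ t ∈ D, HasDerivAt ρ (-3 * (ρ t + P (ρ t) / c ^ 2) * (deriv a t / a t)) t :=
    fun t ht => (h t ht).2.2.2.2
  have hv_nonneg : ∀ t ∈ D, 0 ≤ deriv a t := fun t ht =>
    (mul_nonneg (sqrt_nonneg _) (h t ht).1.le).trans (hlow t ht)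
  have hmono : MonotoneOn a D := monotoneOn_of_hasDerivAt_nonneg hD hda hv_nonneg
  have hHlow : ∀ t ∈ D, √(c ^ 2 * Λ / 3) ≤ deriv a t / a t := fun t ht =>
    (le_div_iff₀ (h t ht).1).2 (hlow t ht)
  have hρle : ∀ t ∈ D, -3 * (ρ t + P (ρ t) / c ^ 2) * (deriv a t / a t) ≤
      -(3 * √(c ^ 2 * Λ / 3)) * ρ t := fun t ht =>
    (hP.density_rate_bounds hc (h t ht).2.1 (sqrt_nonneg _) (hHlow t ht) le_rfl).2
  have hanti : AntitoneOn ρ D := by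
    refine antitoneOn_of_hasDerivWithinAt_nonpos hD
      (fun x hx => (hdρ x hx).continuousAt.continuousWithinAt)
      (fun x hx => (hdρ x (interior_subset hx)).hasDerivWithinAt) fun x hx => ?_
    have hx := interior_subset hx
    have : 0 ≤ 3 * √(c ^ 2 * Λ / 3) * ρ x := by
      have := (h x hx).2.1
      positivity
    linarith [hρle x hx]
  have hHup : ∀ t ∈ D, deriv a t / a t ≤ deriv a 0 / a 0 := fun t ht => by
    obtain ⟨k, hk, hsq⟩ := h.sq_deriv_eq hD h0 hnn hK
    have ha0 := (h 0 h0).1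
    have ha := (h t ht).1
    have h1 : a 0 ^ 2 ≤ a t ^ 2 := pow_le_pow_left₀ ha0.le (hmono h0 ht (hnn t ht)) 2
    have h2 : 8 * Real.pi * G / 3 * ρ t ≤ 8 * Real.pi * G / 3 * ρ 0 :=
      mul_le_mul_of_nonneg_left (hanti h0 ht (hnn t ht)) (by positivity)
    have h3 := mul_le_mul_of_nonneg_right h2 (by positivity : 0 ≤ a t ^ 2 * a 0 ^ 2)
    have h4 := mul_le_mul_of_nonneg_left h1 hk
    rw [div_le_div_iff₀ ha ha0]
    refine le_of_sq_le_sq ?_ (by positivity)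
    rw [mul_pow, mul_pow, hsq t ht, hsq 0 h0]
    linarith
  refine ⟨hmono, hanti, fun t ht => ⟨?_, ?_, ?_, ?_⟩⟩
  · exact mul_exp_le_of_hasDerivAt hD hda hlow h0 ht (hnn t ht)
  · exact le_mul_exp_of_hasDerivAt hD hda
      (fun x hx => (div_le_iff₀ (h x hx).1).1 (hHup x hx)) h0 ht (hnn t ht)
  · exact mul_exp_le_of_hasDerivAt hD hdρ
      (fun x hx => (hP.density_rate_bounds hc (h x hx).2.1 (sqrt_nonneg _) (hHlow x hx)
        (hHup x hx)).1) h0 ht (hnn t ht)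
  · exact le_mul_exp_of_hasDerivAt hD hdρ hρle h0 ht (hnn t ht)

/-- An expanding solution with `K ≤ 0` on `[0, T[` has a limit in the phase domain at `T`. -/
theorem IsFriedmannSolution.exists_tendsto (hG : 0 < G) (hc : 0 < c) (hΛ : 0 < Λ)
    (hP : A0 c P) {T : ℝ} (hT : 0 < T)
    (h : IsFriedmannSolution c G Λ P a ρ (Ico 0 T)) (hv : 0 < deriv a 0)
    (hK : (8 * Real.pi * G / 3 * ρ 0 + c ^ 2 * Λ / 3) * a 0 ^ 2 ≤ deriv a 0 ^ 2) :
    ∃ y : ℝ × ℝ × ℝ, 0 < y.1 ∧ 0 < y.2.2 ∧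
      Tendsto (fun r => (a r, deriv a r, ρ r)) (𝓝[<] T) (𝓝 y) := by
  have hD := convex_Ico (𝕜 := ℝ) 0 T
  have h0 : (0 : ℝ) ∈ Ico 0 T := ⟨le_rfl, hT⟩
  have hnn : ∀ t ∈ Ico 0 T, 0 ≤ t := fun t ht => ht.1
  obtain ⟨hmono, hanti, hb⟩ := h.expanding hG hc hΛ hP hD h0 hnn hv hK
  obtain ⟨k, hk, hsq⟩ := h.sq_deriv_eq hD h0 hnn hK
  have ha0 := (h 0 h0).1
  have hρ0 := (h 0 h0).2.1
  have hH : 0 ≤ deriv a 0 / a 0 := by positivity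
  have hsub : Ioo 0 T ⊆ Ico 0 T := Ioo_subset_Ico_self
  have hρlow : ∀ t ∈ Ico 0 T, ρ 0 * exp (-(6 * (deriv a 0 / a 0)) * T) ≤ ρ t := fun t ht => by
    refine le_trans (mul_le_mul_of_nonneg_left (exp_le_exp.2 ?_) hρ0.le) (hb t ht).2.2.1
    exact mul_le_mul_of_nonpos_left ht.2.le (by linarith)
  have hlima := (hmono.mono hsub).tendsto_nhdsWithin_Ioo_left (nonempty_Ioo.2 hT) <| by
    refine ⟨a 0 * exp (deriv a 0 / a 0 * T), ?_⟩
    rintro _ ⟨t, ht, rfl⟩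
    refine (hb t (hsub ht)).2.1.trans (mul_le_mul_of_nonneg_left (exp_le_exp.2 ?_) ha0.le)
    exact mul_le_mul_of_nonneg_left ht.2.le hH
  have hlimρ := (hanti.mono hsub).tendsto_nhdsWithin_Ioo_left (nonempty_Ioo.2 hT) <| by
    refine ⟨ρ 0 * exp (-(6 * (deriv a 0 / a 0)) * T), ?_⟩
    rintro _ ⟨t, ht, rfl⟩
    exact hρlow t (hsub ht)
  have hlimv : Tendsto (deriv a) (𝓝[<] T) _ :=
    Tendsto.congr' (f₁ := fun t =>
      √((8 * Real.pi * G / 3 * ρ t + c ^ 2 * Λ / 3) * a t ^ 2 + k))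
      (by
        filter_upwards [Ioo_mem_nhdsLT hT] with t ht
        rw [← hsq t (hsub ht)]
        refine sqrt_sq (le_trans ?_ (h.sqrt_mul_le_deriv hG hc hΛ hD h0 hnn hv hK (hsub ht)))
        exact mul_nonneg (sqrt_nonneg _) (h t (hsub ht)).1.le)
      ((((hlimρ.const_mul _).add_const _).mul (hlima.pow 2)).add_const k).sqrt
  refine ⟨_, ?_, ?_, hlima.prodMk_nhds (hlimv.prodMk_nhds hlimρ)⟩
  · refine ha0.trans_le (ge_of_tendsto hlima ?_)
    filter_upwards [Ioo_mem_nhdsLT hT] with t ht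
    exact hmono h0 (hsub ht) ht.1.le
  · refine lt_of_lt_of_le (mul_pos hρ0 (exp_pos (-(6 * (deriv a 0 / a 0)) * T)))
      (ge_of_tendsto hlimρ ?_)
    filter_upwards [Ioo_mem_nhdsLT hT] with t ht
    exact hρlow t (hsub ht)

end Expanding

/-- Corollary 2: under (A0) and (A1), if `ȧ₀ > 0` and `K ≤ 0`, i.e.
`(8πG/3 ρ₀ + c²Λ/3) a₀² ≤ ȧ₀²`, then `t₊ = +∞` and `a(t) → +∞`, `ρ(t) → 0`
as `t → +∞`. -/
theorem expanding_universe_of_nonpos_curvature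
    (c G Λ : ℝ) (hc : 0 < c) (hG : 0 < G) (hΛ : 0 < Λ)
    (P : ℝ → ℝ) (hA0 : A0 c P) (hA1 : ∃ Γ σ : ℝ, A1 c P Γ σ)
    (a ρ : ℝ → ℝ) (tm tp : EReal)
    (hmax : IsMaximalSolution c G Λ P a ρ tm tp)
    (a0 adot0 ρ0 : ℝ) (ha0 : a 0 = a0) (hadot0 : deriv a 0 = adot0) (hρ0 : ρ 0 = ρ0)
    (ha0pos : 0 < a0) (hρ0pos : 0 < ρ0) (hadot0pos : 0 < adot0)
    (hK : (8 * Real.pi * G / 3 * ρ0 + c ^ 2 * Λ / 3) * a0 ^ 2 ≤ adot0 ^ 2) :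
    tp = ⊤ ∧
      Filter.Tendsto a Filter.atTop Filter.atTop ∧
      Filter.Tendsto ρ Filter.atTop (nhds 0) := by
  subst ha0 hadot0 hρ0
  obtain ⟨htm, htp, hsol, hext⟩ := hmax
  obtain rfl : tp = ⊤ := by
    by_contra hne
    lift tp to ℝ using ⟨hne, (EReal.bot_lt_zero.trans htp).ne'⟩
    have hT : 0 < tp := by exact_mod_cast htp
    obtain ⟨s, hs, hs0⟩ := EReal.lt_iff_exists_real_btwn.1 htm
    have hs0' : s < 0 := by exact_mod_cast hs0
    have hIoo : IsFriedmannSolution c G Λ P a ρ (Ioo s tp) := hsol.mono fun t ht =>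
      ⟨hs.trans (by exact_mod_cast ht.1), by exact_mod_cast ht.2⟩
    obtain ⟨y, hy1, hy2, hlim⟩ := (hIoo.mono fun t ht => ⟨hs0'.trans_le ht.1, ht.2⟩ :
      IsFriedmannSolution c G Λ P a ρ (Ico 0 tp)).exists_tendsto hG hc hΛ hA0 hT hadot0pos hK
    obtain ⟨b, σ, u, hu, hb, hb0, hdb0, hσ0⟩ :=
      hIoo.exists_extension hA0 hs0' hT hy1 hy2 hlim
    have := (hext b σ s u hs0' (hT.trans hu) hb hb0 hdb0 hσ0).2
    exact absurd hu (not_lt.2 (by exact_mod_cast this))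
  have hIci : IsFriedmannSolution c G Λ P a ρ (Ici 0) := hsol.mono fun t ht =>
    ⟨htm.trans_le (by exact_mod_cast ht), EReal.coe_lt_top t⟩
  have hb := (hIci.expanding hG hc hΛ hA0 (convex_Ici 0) self_mem_Ici (fun t ht => ht)
    hadot0pos hK).2.2
  have hrate : 0 < √(c ^ 2 * Λ / 3) := by positivity
  refine ⟨rfl, ?_, ?_⟩
  · refine tendsto_atTop_mono' atTop ?_ (Tendsto.const_mul_atTop ha0pos
      (tendsto_exp_atTop.comp (tendsto_id.const_mul_atTop hrate)))
    filter_upwards [eventually_ge_atTop 0] with t ht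
    exact (hb t ht).1
  · have hlim : Tendsto (fun t => ρ 0 * exp (-(3 * √(c ^ 2 * Λ / 3)) * t)) atTop (𝓝 0) := by
      simpa using (tendsto_exp_atBot.comp (tendsto_id.const_mul_atTop_of_neg
        (by linarith : -(3 * √(c ^ 2 * Λ / 3)) < 0))).const_mul (ρ 0)
    refine tendsto_of_tendsto_of_tendsto_of_le_of_le' tendsto_const_nhds hlim ?_ ?_
    · filter_upwards [eventually_ge_atTop 0] with t ht
      exact (hIci t ht).2.1.le
    · filter_upwards [eventually_ge_atTop 0] with t ht
      exact (hb t ht).2.2.2
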